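/- arXiv:1606.06071 — 2 statements merged into one kernel-verified Lean document; each statement's English description precedes it below -/
import Mathlib

section
/- Let Ω ⊂ ℝ^N be a bounded convex domain and σ(x) = √(|x-x₀|² + K²h²) for some x₀ ∈ Ω, h, K > 0. For each α ∈ ℝ there is a constant C > 0 (depending only on α and the Lipschitz bound |∇σ| ≤ 1) such that for every v ∈ H¹₀(Ω) ∩ H²(Ω): ‖σ^α ∇v‖_{L²(Ω)} ≤ C ( ‖σ^{α+1} Δv‖_{L²(Ω)} + ‖σ^{α-1} v‖_{L²(Ω)} ), provided the right-hand side is finite. -/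
open Real MeasureTheory

section ExtensionByZero

variable {E : Type*} [NormedAddCommGroup E] [NormedSpace ℝ E]

theorem exists_mem_segment_frontier {s : Set E} (hs : IsOpen s) {x y : E} (hx : x ∈ s)
    (hy : y ∉ s) : ∃ z ∈ segment ℝ x y, z ∈ frontier s := by
  by_contra! hz
  have hcover : segment ℝ x y ⊆ s ∪ (closure s)ᶜ := fun z hzs => by
    by_contra hzu
    rw [Set.mem_union, Set.mem_compl_iff, not_or, not_not] at hzu
    exact hz z hzs (hs.frontier_eq ▸ ⟨hzu.2, hzu.1⟩)
  have hy' : y ∈ (closure s)ᶜ :=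
    (hcover (right_mem_segment ℝ x y)).resolve_left hy
  obtain ⟨z, -, hzs, hzc⟩ := (convex_segment (𝕜 := ℝ) x y).isPreconnected s (closure s)ᶜ hs
    isClosed_closure.isOpen_compl hcover ⟨x, left_mem_segment ℝ x y, hx⟩
    ⟨y, right_mem_segment ℝ x y, hy'⟩
  exact hzc (subset_closure hzs)

/-- The extension by zero of a function that is Lipschitz on the closure of an open set and
vanishes on its frontier is Lipschitz. -/
theorem LipschitzOnWith.lipschitzWith_indicator {s : Set E} (hs : IsOpen s) {u : E → ℝ}
    {L : NNReal} (hu : LipschitzOnWith L u (closure s)) (h0 : ∀ x ∈ frontier s, u x = 0) :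
    LipschitzWith L (s.indicator u) := by
  have key : ∀ x ∈ s, ∀ y ∉ s, |u x| ≤ L * dist x y := fun x hx y hy => by
    obtain ⟨z, hzs, hzf⟩ := exists_mem_segment_frontier hs hx hy
    have h1 := hu.dist_le_mul x (subset_closure hx) z (frontier_subset_closure hzf)
    rw [h0 z hzf, Real.dist_eq, sub_zero] at h1
    refine h1.trans (mul_le_mul_of_nonneg_left ?_ L.coe_nonneg)
    have := dist_add_dist_of_mem_segment hzs
    linarith [dist_nonneg (x := z) (y := y)]
  refine LipschitzWith.of_dist_le_mul fun x y => ?_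
  by_cases hx : x ∈ s <;> by_cases hy : y ∈ s
  · simpa [hx, hy] using hu.dist_le_mul x (subset_closure hx) y (subset_closure hy)
  · simpa [hx, hy, Real.dist_eq] using key x hx y hy
  · simpa [hx, hy, Real.dist_eq, dist_comm] using key y hy x hx
  · simp only [hx, hy, not_false_eq_true, Set.indicator_of_notMem, dist_self]
    positivity

/-- A directional derivative of a `C¹` function vanishing on the boundary of a bounded open convex
set integrates to zero over that set. -/
theorem setIntegral_fderiv_eq_zero [FiniteDimensional ℝ E] [MeasurableSpace E] [BorelSpace E]
    (μ : Measure E) [μ.IsAddHaarMeasure] {s : Set E} (hs : IsOpen s) (hconv : Convex ℝ s)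
    (hb : Bornology.IsBounded s) {u : E → ℝ} (hu : ContDiff ℝ 1 u)
    (h0 : ∀ x ∈ frontier s, u x = 0) (e : E) : ∫ x in s, fderiv ℝ u x e ∂μ = 0 := by
  have hc : IsCompact (closure s) := hb.isCompact_closure
  obtain ⟨L, hL⟩ := hu.locallyLipschitz.locallyLipschitzOn.exists_lipschitzOnWith_of_compact hc
  have hcs : HasCompactSupport (s.indicator u) :=
    HasCompactSupport.intro hc fun x hx =>
      Set.indicator_of_notMem (fun h => hx (subset_closure h)) u
  have hibp := (LipschitzWith.const (1 : ℝ)).integral_lineDeriv_mul_eq (μ := μ)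
    (hL.lipschitzWith_indicator hs h0) hcs (-e)
  have hconst : ∀ x v : E, lineDeriv ℝ (fun _ : E => (1 : ℝ)) x v = 0 := fun x v => by
    simp [lineDeriv]
  simp only [hconst, zero_mul, integral_zero, neg_neg, mul_one] at hibp
  rw [← integral_indicator hs.measurableSet, hibp]
  refine integral_congr_ae ?_
  filter_upwards [measure_eq_zero_iff_ae_notMem.1 (hconv.addHaar_frontier μ)] with x hx
  by_cases hxs : x ∈ s
  · rw [Set.indicator_of_mem hxs,
      ← ((hu.differentiable one_ne_zero) x).lineDeriv_eq_fderiv]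
    refine Filter.EventuallyEq.lineDeriv_eq ?_
    filter_upwards [hs.mem_nhds hxs] with y hy
    simp [hy]
  · have hxc : x ∈ (closure s)ᶜ := fun h => hx (hs.frontier_eq ▸ ⟨h, hxs⟩)
    have : s.indicator u =ᶠ[nhds x] fun _ => 0 := by
      filter_upwards [isClosed_closure.isOpen_compl.mem_nhds hxc] with y hy
      exact Set.indicator_of_notMem (fun h => hy (subset_closure h)) u
    rw [Set.indicator_of_notMem hxs, this.lineDeriv_eq]
    simp [lineDeriv]

end ExtensionByZero

section WeightedEnergy

variable {N : ℕ}

local notation "𝔼" => EuclideanSpace ℝ (Fin N)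

theorem gradient_apply_eq_fderiv_single (v : 𝔼 → ℝ) (x : 𝔼) (i : Fin N) :
    gradient v x i = fderiv ℝ v x (EuclideanSpace.single i 1) := by
  have h := InnerProductSpace.toDual_apply_apply (𝕜 := ℝ) (x := gradient v x)
    (y := EuclideanSpace.single i 1)
  rw [toDual_gradient, EuclideanSpace.inner_single_right] at h
  simpa only [one_mul, conj_trivial] using h.symm

theorem fderiv_apply_gradient_eq_sum (ψ v : 𝔼 → ℝ) (x : 𝔼) :
    fderiv ℝ ψ x (gradient v x) = ∑ i, fderiv ℝ ψ x (EuclideanSpace.single i 1) *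
      fderiv ℝ v x (EuclideanSpace.single i 1) := by
  simp only [← gradient_apply_eq_fderiv_single]
  rw [← toDual_gradient, InnerProductSpace.toDual_apply_apply, PiLp.inner_apply]
  simp [mul_comm]

theorem norm_gradient_sq_eq_sum (v : 𝔼 → ℝ) (x : 𝔼) :
    ‖gradient v x‖ ^ 2 = ∑ i, fderiv ℝ v x (EuclideanSpace.single i 1) ^ 2 := by
  simp [EuclideanSpace.real_norm_sq_eq, gradient_apply_eq_fderiv_single]

theorem ContDiff.continuous_gradient {v : 𝔼 → ℝ} (hv : ContDiff ℝ 1 v) :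
    Continuous (gradient v) :=
  (InnerProductSpace.toDual ℝ 𝔼).symm.continuous.comp (hv.continuous_fderiv one_ne_zero)

theorem fderiv_mul_mul_fderiv_apply {v ψ : 𝔼 → ℝ} (hv : ContDiff ℝ 2 v) (hψ : ContDiff ℝ 1 ψ)
    (x e : 𝔼) :
    fderiv ℝ (fun y => v y * ψ y * fderiv ℝ v y e) x e =
      ψ x * fderiv ℝ v x e ^ 2 + v x * ψ x * iteratedFDeriv ℝ 2 v x ![e, e] +
        v x * (fderiv ℝ ψ x e * fderiv ℝ v x e) := by
  have h1 : HasFDerivAt v (fderiv ℝ v x) x := (hv.differentiable two_ne_zero x).hasFDerivAt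
  have h2 : HasFDerivAt ψ (fderiv ℝ ψ x) x := (hψ.differentiable one_ne_zero x).hasFDerivAt
  have h3 : HasFDerivAt (fderiv ℝ v) (fderiv ℝ (fderiv ℝ v) x) x :=
    ((hv.fderiv_right (m := 1) (by norm_num)).differentiable one_ne_zero x).hasFDerivAt
  have h := (h1.mul h2).mul (h3.clm_apply (hasFDerivAt_const e x))
  rw [show fderiv ℝ (fun y => v y * ψ y * fderiv ℝ v y e) x = _ from h.fderiv,
    iteratedFDeriv_two_apply]
  simp
  ring

/-- Green's identity on a bounded convex domain for `ψ ∇v` tested against `v`. -/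
theorem setIntegral_weighted_green {s : Set 𝔼} (hs : IsOpen s) (hconv : Convex ℝ s)
    (hb : Bornology.IsBounded s) {v ψ : 𝔼 → ℝ} (hv : ContDiff ℝ 2 v) (hψ : ContDiff ℝ 1 ψ)
    (h0 : ∀ x ∈ frontier s, v x = 0) :
    ∫ x in s, (ψ x * ‖gradient v x‖ ^ 2 + v x * ψ x * (∑ i : Fin N, iteratedFDeriv ℝ 2 v x
      ![EuclideanSpace.single i (1 : ℝ), EuclideanSpace.single i (1 : ℝ)]) +
      v x * fderiv ℝ ψ x (gradient v x)) = 0 := by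
  have hu (e : 𝔼) : ContDiff ℝ 1 (fun y => v y * ψ y * fderiv ℝ v y e) :=
    ((hv.of_le (by norm_num)).mul hψ).mul
      ((hv.fderiv_right (m := 1) (by norm_num)).clm_apply contDiff_const)
  have hint (e : 𝔼) :
      IntegrableOn (fun x => fderiv ℝ (fun y => v y * ψ y * fderiv ℝ v y e) x e) s :=
    ((((hu e).continuous_fderiv one_ne_zero).clm_apply
      continuous_const).continuousOn.integrableOn_compact hb.isCompact_closure).mono_set
      subset_closure
  calc _ = ∫ x in s, ∑ i : Fin N, fderiv ℝ (fun y => v y * ψ y *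
        fderiv ℝ v y (EuclideanSpace.single i 1)) x (EuclideanSpace.single i 1) := by
        congr 1 with x
        simp only [fderiv_mul_mul_fderiv_apply hv hψ, norm_gradient_sq_eq_sum,
          fderiv_apply_gradient_eq_sum, Finset.sum_add_distrib, Finset.mul_sum]
    _ = 0 := by
        rw [integral_finsetSum _ fun i _ => hint _]
        exact Finset.sum_eq_zero fun i _ =>
          setIntegral_fderiv_eq_zero volume hs hconv hb (hu _) (fun x hx => by simp [h0 x hx]) _

theorem contDiff_sqrt_norm_sq_add_rpow {c : ℝ} (hc : 0 < c) (x₀ : 𝔼) (β : ℝ) {n : WithTop ℕ∞} :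
    ContDiff ℝ n fun x : 𝔼 => √(‖x - x₀‖ ^ 2 + c) ^ β := by
  have hpos (x : 𝔼) : 0 < ‖x - x₀‖ ^ 2 + c := by positivity
  have h : ContDiff ℝ n fun x : 𝔼 => ‖x - x₀‖ ^ 2 + c :=
    ((contDiff_id.sub contDiff_const).norm_sq ℝ).add contDiff_const
  exact (h.sqrt fun x => (hpos x).ne').rpow_const_of_ne fun x => (Real.sqrt_pos.2 (hpos x)).ne'

theorem fderiv_sqrt_norm_sq_add_rpow_apply {c : ℝ} (hc : 0 < c) (x₀ x w : 𝔼) (α : ℝ) :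
    fderiv ℝ (fun x : 𝔼 => √(‖x - x₀‖ ^ 2 + c) ^ (2 * α)) x w =
      2 * α * √(‖x - x₀‖ ^ 2 + c) ^ (2 * (α - 1)) * inner ℝ (x - x₀) w := by
  have hpos (x : 𝔼) : 0 < ‖x - x₀‖ ^ 2 + c := by positivity
  have hsq (x : 𝔼) (β : ℝ) :
      √(‖x - x₀‖ ^ 2 + c) ^ (2 * β) = (‖x - x₀‖ ^ 2 + c) ^ β := by
    rw [Real.rpow_mul (Real.sqrt_nonneg _), Real.rpow_two, Real.sq_sqrt (hpos x).le]
  simp only [hsq]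
  have h := ((((hasFDerivAt_id x).sub_const x₀).norm_sq).add_const c).rpow_const
    (p := α) (Or.inl (hpos x).ne')
  rw [show fderiv ℝ (fun x : 𝔼 => (‖x - x₀‖ ^ 2 + c) ^ α) x = _ from h.fderiv]
  simp [inner_sub_left]
  ring

theorem weighted_energy_pointwise_bound {α t S n b D p g : ℝ} (ht : 0 < t)
    (hp : |p| ≤ S * n) (hg : g = 2 * α * t * p) :
    1 / 2 * (t * S ^ 2 * n ^ 2) ≤
      (t * S ^ 2 * n ^ 2 + b * (t * S ^ 2) * D + b * g) +
        1 / 2 * (t * S ^ 4 * D ^ 2) + (1 / 2 + 2 * α ^ 2) * (t * b ^ 2) := by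
  have hp2 : p ^ 2 ≤ S ^ 2 * n ^ 2 := by
    rw [← mul_pow]
    exact sq_le_sq' (abs_le.1 hp).1 (abs_le.1 hp).2
  have h1 := mul_le_mul_of_nonneg_left hp2 ht.le
  have h2 := mul_nonneg ht.le (sq_nonneg (b + S ^ 2 * D))
  have h3 := mul_nonneg ht.le (sq_nonneg (p + 2 * α * b))
  subst hg
  nlinarith

end WeightedEnergy

theorem stmt4 (N : ℕ) (α : ℝ) :
    ∃ C > 0, ∀ (Ω : Set (EuclideanSpace ℝ (Fin N))), IsOpen Ω → Convex ℝ Ω →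
      Bornology.IsBounded Ω →
      ∀ (x₀ : EuclideanSpace ℝ (Fin N)), x₀ ∈ Ω → ∀ (h K : ℝ), 0 < h → 0 < K →
      ∀ v : EuclideanSpace ℝ (Fin N) → ℝ, ContDiff ℝ 2 v →
      (∀ x ∈ frontier Ω, v x = 0) →
      IntegrableOn (fun x => (Real.sqrt (‖x - x₀‖ ^ 2 + K ^ 2 * h ^ 2)) ^ (2 * (α + 1)) *
        (∑ i : Fin N, iteratedFDeriv ℝ 2 v x
          ![EuclideanSpace.single i (1 : ℝ), EuclideanSpace.single i (1 : ℝ)]) ^ 2) Ω →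
      IntegrableOn (fun x => (Real.sqrt (‖x - x₀‖ ^ 2 + K ^ 2 * h ^ 2)) ^ (2 * (α - 1)) *
        (v x) ^ 2) Ω →
      Real.sqrt (∫ x in Ω,
          (Real.sqrt (‖x - x₀‖ ^ 2 + K ^ 2 * h ^ 2)) ^ (2 * α) * ‖gradient v x‖ ^ 2) ≤
        C * (Real.sqrt (∫ x in Ω,
              (Real.sqrt (‖x - x₀‖ ^ 2 + K ^ 2 * h ^ 2)) ^ (2 * (α + 1)) *
              (∑ i : Fin N, iteratedFDeriv ℝ 2 v x
                ![EuclideanSpace.single i (1 : ℝ), EuclideanSpace.single i (1 : ℝ)]) ^ 2) +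
            Real.sqrt (∫ x in Ω,
              (Real.sqrt (‖x - x₀‖ ^ 2 + K ^ 2 * h ^ 2)) ^ (2 * (α - 1)) * (v x) ^ 2)) := by
  refine ⟨1 + 4 * α ^ 2, by positivity, ?_⟩
  intro Ω hΩ hconv hb x₀ _ h K hh hK v hv h0 hQ hP
  have hc : 0 < K ^ 2 * h ^ 2 := by positivity
  generalize K ^ 2 * h ^ 2 = c at *
  have hψ : ContDiff ℝ 1 fun x : EuclideanSpace ℝ (Fin N) => √(‖x - x₀‖ ^ 2 + c) ^ (2 * α) :=
    contDiff_sqrt_norm_sq_add_rpow hc x₀ _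
  have hgrad := (hv.of_le (by norm_num : (1 : WithTop ℕ∞) ≤ 2)).continuous_gradient
  have hlap : Continuous fun x => ∑ i : Fin N, iteratedFDeriv ℝ 2 v x
      ![EuclideanSpace.single i (1 : ℝ), EuclideanSpace.single i (1 : ℝ)] :=
    continuous_finsetSum _ fun i _ =>
      (ContinuousMultilinearMap.apply ℝ (fun _ : Fin 2 => EuclideanSpace ℝ (Fin N)) ℝ
        ![EuclideanSpace.single i (1 : ℝ), EuclideanSpace.single i (1 : ℝ)]).continuous.comp
        (hv.continuous_iteratedFDeriv (m := 2) le_rfl)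
  have hloc {f : EuclideanSpace ℝ (Fin N) → ℝ} (hf : Continuous f) : IntegrableOn f Ω :=
    (hf.continuousOn.integrableOn_compact hb.isCompact_closure).mono_set subset_closure
  have hA : IntegrableOn
      (fun x => √(‖x - x₀‖ ^ 2 + c) ^ (2 * α) * ‖gradient v x‖ ^ 2) Ω :=
    hloc (hψ.continuous.mul (hgrad.norm.pow 2))
  have hG := setIntegral_weighted_green hΩ hconv hb hv hψ h0
  have hGint := hloc (((hψ.continuous.mul (hgrad.norm.pow 2)).add
    ((hv.continuous.mul hψ.continuous).mul hlap)).add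
    (hv.continuous.mul ((hψ.continuous_fderiv one_ne_zero).clm_apply hgrad)))
  have hmono := integral_mono (hA.const_mul (1 / 2))
    ((hGint.add (hQ.const_mul (1 / 2))).add (hP.const_mul (1 / 2 + 2 * α ^ 2))) fun x => by
      have hpos : 0 < ‖x - x₀‖ ^ 2 + c := by positivity
      have hS : 0 < √(‖x - x₀‖ ^ 2 + c) := Real.sqrt_pos.2 hpos
      have hxS : ‖x - x₀‖ ≤ √(‖x - x₀‖ ^ 2 + c) := Real.le_sqrt_of_sq_le (by linarith)
      have e1 : √(‖x - x₀‖ ^ 2 + c) ^ (2 * α) =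
          √(‖x - x₀‖ ^ 2 + c) ^ (2 * (α - 1)) * √(‖x - x₀‖ ^ 2 + c) ^ 2 := by
        rw [← Real.rpow_add_natCast hS.ne']
        congr 1
        push_cast
        ring
      have e2 : √(‖x - x₀‖ ^ 2 + c) ^ (2 * (α + 1)) =
          √(‖x - x₀‖ ^ 2 + c) ^ (2 * (α - 1)) * √(‖x - x₀‖ ^ 2 + c) ^ 4 := by
        rw [← Real.rpow_add_natCast hS.ne']
        congr 1
        push_cast
        ring
      have hbound := weighted_energy_pointwise_bound (b := v x)
        (D := ∑ i : Fin N, iteratedFDeriv ℝ 2 v x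
          ![EuclideanSpace.single i (1 : ℝ), EuclideanSpace.single i (1 : ℝ)])
        (Real.rpow_pos_of_pos hS (2 * (α - 1)))
        ((abs_real_inner_le_norm _ _).trans
          (mul_le_mul_of_nonneg_right hxS (norm_nonneg (gradient v x))))
        (fderiv_sqrt_norm_sq_add_rpow_apply hc x₀ x (gradient v x) α)
      rw [← e1, ← e2] at hbound
      exact hbound
  have hsplit : ∀ f g k : EuclideanSpace ℝ (Fin N) → ℝ, IntegrableOn f Ω → IntegrableOn g Ω →
      IntegrableOn k Ω → ∀ a b : ℝ, ∫ x in Ω, (f x + a * g x + b * k x) =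
        (∫ x in Ω, f x) + a * (∫ x in Ω, g x) + b * ∫ x in Ω, k x := by
    intro f g k hf hg hk a b
    have hfg : IntegrableOn (fun x => f x + a * g x) Ω := hf.add (hg.const_mul a)
    rw [integral_add hfg (hk.const_mul b), integral_add hf (hg.const_mul a),
      integral_const_mul, integral_const_mul]
  have hsum := hmono.trans_eq (hsplit _ _ _ hGint hQ hP (1 / 2) (1 / 2 + 2 * α ^ 2))
  rw [integral_const_mul] at hsum
  replace hsum := hsum.trans_eq (congrArg₂ _ (congrArg₂ _ hG rfl) rfl)
  have hQ0 := Real.sq_sqrt (setIntegral_nonneg (μ := volume) hΩ.measurableSet fun x _ =>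
    (by positivity : 0 ≤ √(‖x - x₀‖ ^ 2 + c) ^ (2 * (α + 1)) * (∑ i : Fin N,
      iteratedFDeriv ℝ 2 v x
        ![EuclideanSpace.single i (1 : ℝ), EuclideanSpace.single i (1 : ℝ)]) ^ 2))
  have hP0 := Real.sq_sqrt (setIntegral_nonneg (μ := volume) hΩ.measurableSet fun x _ =>
    (by positivity : 0 ≤ √(‖x - x₀‖ ^ 2 + c) ^ (2 * (α - 1)) * v x ^ 2))
  rw [← hQ0, ← hP0] at hsum
  set q := √(∫ x in Ω, √(‖x - x₀‖ ^ 2 + c) ^ (2 * (α + 1)) * (∑ i : Fin N,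
      iteratedFDeriv ℝ 2 v x
        ![EuclideanSpace.single i (1 : ℝ), EuclideanSpace.single i (1 : ℝ)]) ^ 2)
  set p := √(∫ x in Ω, √(‖x - x₀‖ ^ 2 + c) ^ (2 * (α - 1)) * v x ^ 2)
  have hq : 0 ≤ q := Real.sqrt_nonneg _
  have hp : 0 ≤ p := Real.sqrt_nonneg _
  refine Real.sqrt_le_iff.2 ⟨by positivity, ?_⟩
  have hC : 1 + 4 * α ^ 2 ≤ (1 + 4 * α ^ 2) ^ 2 := by nlinarith [sq_nonneg α]
  calc _ ≤ q ^ 2 + (1 + 4 * α ^ 2) * p ^ 2 := by linarith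
    _ ≤ (1 + 4 * α ^ 2) * (q + p) ^ 2 := by
      nlinarith [mul_nonneg (sq_nonneg α) (sq_nonneg q), mul_nonneg hq hp,
        mul_nonneg (sq_nonneg α) (mul_nonneg hq hp)]
    _ ≤ (1 + 4 * α ^ 2) ^ 2 * (q + p) ^ 2 := by gcongr
    _ = _ := by ring
end

section
/- Let Ω ⊂ ℝ³ be a bounded convex domain and σ(x) = √(|x-x₀|² + K²h²) with x₀ ∈ Ω, h, K > 0. Then for all f ∈ H¹₀(Ω), all α ≥ -1/2, all β ∈ ℝ, and all 1 ≤ p ≤ ∞ with conjugate exponent p′: ‖σ^α f‖²_{L²(Ω)} ≤ C ‖σ^{α-β} f‖_{L^p(Ω)} ‖σ^{α+1+β} ∇f‖_{L^{p′}(Ω)}, with C independent of K, h, and f, provided both factors on the right are finite. -/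
open Real MeasureTheory ENNReal

/-- The integral form of `div (w (x - x₀)) = n w + Dw (x - x₀)` for a compactly supported `w`. -/
theorem integral_fderiv_apply_sub_eq_neg_card_mul {ι : Type*} [Fintype ι]
    {w : EuclideanSpace ℝ ι → ℝ} (hw : ContDiff ℝ 1 w) (hc : HasCompactSupport w)
    (x₀ : EuclideanSpace ℝ ι) :
    ∫ x, fderiv ℝ w x (x - x₀) = -(Fintype.card ι * ∫ x, w x) := by
  classical
  have hw' : Continuous (fderiv ℝ w) := hw.continuous_fderiv one_ne_zero
  have hwc : Continuous w := hw.continuous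
  let b : ι → EuclideanSpace ℝ ι := fun i => EuclideanSpace.single i 1
  have hcoord (i : ι) (x : EuclideanSpace ℝ ι) :
      HasFDerivAt (fun x : EuclideanSpace ℝ ι => (x - x₀) i) (EuclideanSpace.proj i : StrongDual ℝ (EuclideanSpace ℝ ι)) x := by
    simpa using! (EuclideanSpace.proj (𝕜 := ℝ) i).hasFDerivAt.sub_const (x₀ i)
  have hcoord_cont (i : ι) : Continuous fun x : EuclideanSpace ℝ ι => (x - x₀) i := by
    fun_prop
  have hdir_cont (i : ι) : Continuous fun x => fderiv ℝ w x (b i) := by fun_prop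
  have hint (i : ι) : Integrable fun x => (x - x₀) i * fderiv ℝ w x (b i) := by
    refine ((hcoord_cont i).mul (hdir_cont i)).integrable_of_hasCompactSupport ?_
    exact (hc.fderiv_apply ℝ (b i)).mul_left
  have hw_int : Integrable w := hwc.integrable_of_hasCompactSupport hc
  have hfd (i : ι) (x : EuclideanSpace ℝ ι) :
      fderiv ℝ (fun x : EuclideanSpace ℝ ι => (x - x₀) i) x (b i) = 1 := by
    rw [(hcoord i x).fderiv]
    simp [b]
  have key (i : ι) : ∫ x, (x - x₀) i * fderiv ℝ w x (b i) = -∫ x, w x := by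
    rw [integral_mul_fderiv_eq_neg_fderiv_mul_of_integrable]
    · simp only [hfd, one_mul]
    · simpa only [hfd, one_mul] using hw_int
    · exact hint i
    · exact ((hcoord_cont i).mul hwc).integrable_of_hasCompactSupport hc.mul_left
    · exact fun x _ => (hcoord i x).differentiableAt
    · exact fun x _ => hw.differentiable one_ne_zero x
  have hexp (x : EuclideanSpace ℝ ι) :
      fderiv ℝ w x (x - x₀) = ∑ i, (x - x₀) i * fderiv ℝ w x (b i) := by
    conv_lhs => rw [← (EuclideanSpace.basisFun ι ℝ).sum_repr (x - x₀)]
    simp [b]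
  simp_rw [hexp]
  rw [integral_finsetSum _ fun i _ => hint i]
  simp_rw [key]
  simp

section Weight

variable {E : Type*} [NormedAddCommGroup E] {c : ℝ}

theorem sqrt_norm_sub_sq_add_pos (hc : 0 < c) (x₀ x : E) : 0 < √(‖x - x₀‖ ^ 2 + c) := by
  positivity

variable [InnerProductSpace ℝ E]

theorem contDiff_sqrt_norm_sub_sq_add_rpow (hc : 0 < c) (x₀ : E) (r : ℝ) :
    ContDiff ℝ 1 fun x => √(‖x - x₀‖ ^ 2 + c) ^ r := by
  refine ContDiff.rpow_const_of_ne ?_ fun x => (sqrt_norm_sub_sq_add_pos hc x₀ x).ne'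
  refine ContDiff.sqrt ?_ fun x => by positivity
  exact ((contDiff_id.sub contDiff_const).norm_sq ℝ).add contDiff_const

theorem fderiv_sqrt_norm_sub_sq_add_rpow_apply_sub (hc : 0 < c) (x₀ : E) (r : ℝ) (x : E) :
    fderiv ℝ (fun x => √(‖x - x₀‖ ^ 2 + c) ^ r) x (x - x₀) =
      r * √(‖x - x₀‖ ^ 2 + c) ^ (r - 2) * ‖x - x₀‖ ^ 2 := by
  have hpos := sqrt_norm_sub_sq_add_pos hc x₀ x
  have h1 : HasFDerivAt (fun x : E => ‖x - x₀‖ ^ 2 + c) (2 • innerSL ℝ (x - x₀)) x := by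
    simpa using! (((hasFDerivAt_id x).sub_const x₀).norm_sq).add_const c
  have h2 := (h1.sqrt (by positivity)).rpow_const (p := r) (Or.inl hpos.ne')
  rw [h2.fderiv]
  have h3 : √(‖x - x₀‖ ^ 2 + c) ^ (r - 1) =
      √(‖x - x₀‖ ^ 2 + c) ^ (r - 2) * √(‖x - x₀‖ ^ 2 + c) := by
    rw [← rpow_add_one hpos.ne']
    ring_nf
  simp [h3, -map_sub]
  field_simp

/-- The lower bound `div (σ^{2α} f² (x - x₀)) ≥ 2 σ^{2α} f² - 2 σ^{2α+1} |f| |∇f|` in dimension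
three. -/
theorem weighted_divergence_lower_bound [CompleteSpace E] (hc : 0 < c) (x₀ : E) {α : ℝ}
    (hα : -(1 / 2 : ℝ) ≤ α) {f : E → ℝ} (hf : ContDiff ℝ 1 f) (x : E) :
    2 * (√(‖x - x₀‖ ^ 2 + c) ^ (2 * α) * f x ^ 2) -
        2 * (√(‖x - x₀‖ ^ 2 + c) ^ (2 * α + 1) * (|f x| * ‖gradient f x‖)) ≤
      3 * (√(‖x - x₀‖ ^ 2 + c) ^ (2 * α) * f x ^ 2) +
        fderiv ℝ (fun x => √(‖x - x₀‖ ^ 2 + c) ^ (2 * α) * f x ^ 2) x (x - x₀) := by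
  have hpos := sqrt_norm_sub_sq_add_pos hc x₀ x
  have hfd : HasFDerivAt f (fderiv ℝ f x) x := (hf.differentiable one_ne_zero x).hasFDerivAt
  have hσd := ((contDiff_sqrt_norm_sub_sq_add_rpow hc x₀ (2 * α)).differentiable
    one_ne_zero x).hasFDerivAt
  have hderiv : fderiv ℝ (fun x => √(‖x - x₀‖ ^ 2 + c) ^ (2 * α) * f x ^ 2) x (x - x₀) =
      √(‖x - x₀‖ ^ 2 + c) ^ (2 * α) * (2 * f x * fderiv ℝ f x (x - x₀)) +
        f x ^ 2 * (2 * α * √(‖x - x₀‖ ^ 2 + c) ^ (2 * α - 2) * ‖x - x₀‖ ^ 2) := by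
    rw [← fderiv_sqrt_norm_sub_sq_add_rpow_apply_sub hc, (hσd.fun_mul (hfd.pow 2)).fderiv]
    simp
  have hsq : ‖x - x₀‖ ^ 2 ≤ √(‖x - x₀‖ ^ 2 + c) ^ 2 := by
    rw [sq_sqrt (by positivity)]
    linarith
  have hle : ‖x - x₀‖ ≤ √(‖x - x₀‖ ^ 2 + c) := le_of_sq_le_sq hsq hpos.le
  have hrpow : √(‖x - x₀‖ ^ 2 + c) ^ (2 * α) =
      √(‖x - x₀‖ ^ 2 + c) ^ (2 * α - 2) * √(‖x - x₀‖ ^ 2 + c) ^ 2 := by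
    rw [← rpow_add_natCast hpos.ne']
    norm_num
  have hweight : -√(‖x - x₀‖ ^ 2 + c) ^ (2 * α) ≤
      2 * α * √(‖x - x₀‖ ^ 2 + c) ^ (2 * α - 2) * ‖x - x₀‖ ^ 2 := by
    have h0 : 0 ≤ √(‖x - x₀‖ ^ 2 + c) ^ (2 * α - 2) := by positivity
    have h1 : -√(‖x - x₀‖ ^ 2 + c) ^ 2 ≤ 2 * α * ‖x - x₀‖ ^ 2 := by
      nlinarith [sq_nonneg ‖x - x₀‖]
    rw [hrpow]
    nlinarith [mul_le_mul_of_nonneg_left h1 h0]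
  have hgrad : |fderiv ℝ f x (x - x₀)| ≤ ‖gradient f x‖ * √(‖x - x₀‖ ^ 2 + c) := by
    rw [← inner_gradient_left]
    exact (abs_real_inner_le_norm _ _).trans (by gcongr)
  have hcross : -(√(‖x - x₀‖ ^ 2 + c) ^ (2 * α + 1) * (|f x| * ‖gradient f x‖)) ≤
      √(‖x - x₀‖ ^ 2 + c) ^ (2 * α) * (f x * fderiv ℝ f x (x - x₀)) := by
    rw [rpow_add_one hpos.ne']
    have h1 : |f x * fderiv ℝ f x (x - x₀)| ≤
        |f x| * (‖gradient f x‖ * √(‖x - x₀‖ ^ 2 + c)) := by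
      rw [abs_mul]
      gcongr
    have h0 : 0 ≤ √(‖x - x₀‖ ^ 2 + c) ^ (2 * α) := by positivity
    nlinarith [mul_le_mul_of_nonneg_left (neg_le_of_abs_le h1) h0]
  rw [hderiv]
  nlinarith [mul_le_mul_of_nonneg_left hweight (sq_nonneg (f x))]

end Weight

theorem integral_mul_le_toReal_eLpNorm_mul {X : Type*} [MeasurableSpace X] {μ : Measure X}
    {p q : ℝ≥0∞} [p.HolderConjugate q] {u v : X → ℝ} (hu : AEStronglyMeasurable u μ)
    (hv : AEStronglyMeasurable v μ) (hup : eLpNorm u p μ ≠ ⊤) (hvq : eLpNorm v q μ ≠ ⊤) :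
    ∫ x, |u x| * |v x| ∂μ ≤ (eLpNorm u p μ).toReal * (eLpNorm v q μ).toReal := by
  have h : eLpNorm (u • v) 1 μ ≤ eLpNorm u p μ * eLpNorm v q μ :=
    eLpNorm_smul_le_mul_eLpNorm hv hu
  rw [← ENNReal.toReal_mul]
  refine le_trans (le_of_eq ?_) (ENNReal.toReal_mono (ENNReal.mul_ne_top hup hvq) h)
  rw [eLpNorm_one_eq_lintegral_enorm, ← integral_norm_eq_lintegral_enorm (hu.smul hv)]
  simp

theorem stmt10 (Ω : Set (EuclideanSpace ℝ (Fin 3))) (hΩo : IsOpen Ω) (hΩc : Convex ℝ Ω)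
    (hΩb : Bornology.IsBounded Ω) (α β : ℝ) (hα : -(1 / 2 : ℝ) ≤ α)
    (p q : ℝ≥0∞) (hp : 1 ≤ p) (hpq : 1 / p + 1 / q = 1) :
    ∃ C > 0, ∀ (x₀ : EuclideanSpace ℝ (Fin 3)), x₀ ∈ Ω → ∀ h K : ℝ, 0 < h → 0 < K →
      ∀ f : EuclideanSpace ℝ (Fin 3) → ℝ, ContDiff ℝ 1 f → HasCompactSupport f →
      tsupport f ⊆ Ω →
      eLpNorm (fun x => (Real.sqrt (‖x - x₀‖ ^ 2 + K ^ 2 * h ^ 2)) ^ (α - β) * f x) p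
        (volume.restrict Ω) ≠ ⊤ →
      eLpNorm (fun x => (Real.sqrt (‖x - x₀‖ ^ 2 + K ^ 2 * h ^ 2)) ^ (α + 1 + β) *
        ‖gradient f x‖) q (volume.restrict Ω) ≠ ⊤ →
      ∫ x in Ω, (Real.sqrt (‖x - x₀‖ ^ 2 + K ^ 2 * h ^ 2)) ^ (2 * α) * (f x) ^ 2 ≤
        C * (eLpNorm (fun x => (Real.sqrt (‖x - x₀‖ ^ 2 + K ^ 2 * h ^ 2)) ^ (α - β) * f x) p
              (volume.restrict Ω)).toReal *
            (eLpNorm (fun x => (Real.sqrt (‖x - x₀‖ ^ 2 + K ^ 2 * h ^ 2)) ^ (α + 1 + β) *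
              ‖gradient f x‖) q (volume.restrict Ω)).toReal := by
  have hconj : p.HolderConjugate q := ⟨by simpa using hpq⟩
  refine ⟨1, one_pos, fun x₀ _ h K hh hK f hf hfc hfΩ hup hvq => ?_⟩
  have hc : 0 < K ^ 2 * h ^ 2 := by positivity
  generalize K ^ 2 * h ^ 2 = c at *
  have hσ_cont (r : ℝ) : Continuous fun x => √(‖x - x₀‖ ^ 2 + c) ^ r :=
    (contDiff_sqrt_norm_sub_sq_add_rpow hc x₀ r).continuous
  have hgrad_cont : Continuous (gradient f) :=
    (InnerProductSpace.toDual ℝ _).symm.continuous.comp (hf.continuous_fderiv one_ne_zero)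
  have hf_zero : ∀ x, x ∉ Ω → f x = 0 := fun x hx =>
    image_eq_zero_of_notMem_tsupport fun hx' => hx (hfΩ hx')
  set w : EuclideanSpace ℝ (Fin 3) → ℝ :=
    fun x => √(‖x - x₀‖ ^ 2 + c) ^ (2 * α) * f x ^ 2 with hw_def
  set F : EuclideanSpace ℝ (Fin 3) → ℝ :=
    fun x => √(‖x - x₀‖ ^ 2 + c) ^ (2 * α + 1) * (|f x| * ‖gradient f x‖) with hF_def
  have hw : ContDiff ℝ 1 w := (contDiff_sqrt_norm_sub_sq_add_rpow hc x₀ _).mul (hf.pow 2)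
  have hwc : HasCompactSupport w := by
    refine hfc.mono fun x hx hfx => hx ?_
    simp [hw_def, hfx]
  have hFc : HasCompactSupport F := by
    refine hfc.mono fun x hx hfx => hx ?_
    simp [hF_def, hfx]
  have hw_int : Integrable w := hw.continuous.integrable_of_hasCompactSupport hwc
  have hF_int : Integrable F :=
    ((hσ_cont _).mul (hf.continuous.abs.mul hgrad_cont.norm)).integrable_of_hasCompactSupport hFc
  have hDw_int : Integrable fun x => fderiv ℝ w x (x - x₀) := by
    refine ((hw.continuous_fderiv one_ne_zero).clm_apply
      (continuous_id.sub continuous_const)).integrable_of_hasCompactSupport ?_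
    refine (hwc.fderiv ℝ).mono fun x hx hDx => hx ?_
    simp [hDx]
  have hwF : ∫ x, w x ≤ ∫ x, F x := by
    have hmono := integral_mono ((hw_int.const_mul 2).sub (hF_int.const_mul 2))
      ((hw_int.const_mul 3).add hDw_int) (weighted_divergence_lower_bound hc x₀ hα hf)
    have hdiv := integral_fderiv_apply_sub_eq_neg_card_mul hw hwc x₀
    simp only [Pi.sub_apply, Pi.add_apply] at hmono
    rw [integral_sub (hw_int.const_mul 2) (hF_int.const_mul 2),
      integral_add (hw_int.const_mul 3) hDw_int, hdiv] at hmono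
    simp only [integral_const_mul, Fintype.card_fin] at hmono
    norm_num at hmono
    linarith
  have hsplit (x : EuclideanSpace ℝ (Fin 3)) :
      F x = |√(‖x - x₀‖ ^ 2 + c) ^ (α - β) * f x| *
        |√(‖x - x₀‖ ^ 2 + c) ^ (α + 1 + β) * ‖gradient f x‖| := by
    have hpos := sqrt_norm_sub_sq_add_pos hc x₀ x
    have hexp : 2 * α + 1 = (α - β) + (α + 1 + β) := by ring
    simp only [hF_def]
    rw [hexp, rpow_add hpos, abs_mul, abs_mul, abs_norm, abs_of_pos (rpow_pos_of_pos hpos _),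
      abs_of_pos (rpow_pos_of_pos hpos _)]
    ring
  calc ∫ x in Ω, w x = ∫ x, w x :=
        setIntegral_eq_integral_of_forall_compl_eq_zero fun x hx => by
          simp [hw_def, hf_zero x hx]
    _ ≤ ∫ x, F x := hwF
    _ = ∫ x in Ω, F x :=
        (setIntegral_eq_integral_of_forall_compl_eq_zero fun x hx => by
          simp [hF_def, hf_zero x hx]).symm
    _ ≤ _ := by
        simp_rw [hsplit, one_mul]
        exact integral_mul_le_toReal_eLpNorm_mul
          ((hσ_cont _).mul hf.continuous).aestronglyMeasurable
          ((hσ_cont _).mul hgrad_cont.norm).aestronglyMeasurable hup hvq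
end
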